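/- arXiv:1612.00078 — 3 statements merged into one kernel-verified Lean document; each statement's English description precedes it below -/
import Mathlib

section
/- Let α ∈ (0, 1/(2(m−1))] and p = 6/α, and let f satisfy (RegY). There exists a constant C ≥ 0, depending only on L_y, m, R₀ and α (but not on h), such that for every h ∈ (0,1], every ℝ^n-valued random variable Y with E[|Y|^{4p}] < ∞, and every ℝ^{n×d}-valued random matrix ζ, one has | E[ (Y − T^h(Y)) + ( f(Y, ζ) − f(T^h(Y), ζ) ) h ] |² ≤ C (1 + E[|Y|^{4p}]) h³. -/
open MeasureTheory ProbabilityTheory Real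

noncomputable section

/-- `ℝ^n` with the Euclidean norm. -/
abbrev Vec (n : ℕ) := EuclideanSpace ℝ (Fin n)

/-- `ℝ^{n×d}` with the Frobenius norm. -/
abbrev Mat (n d : ℕ) := EuclideanSpace ℝ (Fin n × Fin d)

/-- Metric projection onto the closed Euclidean ball of radius `R` centered at `0`. -/
def proj {n : ℕ} (R : ℝ) (y : Vec n) : Vec n :=
  if ‖y‖ ≤ R then y else (R / ‖y‖) • y

theorem norm_sub_proj_le {n : ℕ} {R : ℝ} (hR : 0 ≤ R) (y : Vec n) : ‖y - proj R y‖ ≤ ‖y‖ := by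
  unfold proj
  split_ifs with hy
  · simp
  · push Not at hy
    have hy0 : 0 < ‖y‖ := hR.trans_lt hy
    have h1 : R / ‖y‖ ≤ 1 := (div_le_one hy0).2 hy.le
    have h0 : 0 ≤ R / ‖y‖ := by positivity
    have hsub : y - (R / ‖y‖) • y = (1 - R / ‖y‖) • y := by rw [sub_smul, one_smul]
    rw [hsub, norm_smul, Real.norm_of_nonneg (by linarith)]
    exact mul_le_of_le_one_left hy0.le (by linarith)

theorem norm_proj_le {n : ℕ} {R : ℝ} (hR : 0 ≤ R) (y : Vec n) : ‖proj R y‖ ≤ ‖y‖ := by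
  unfold proj
  split_ifs with hy
  · exact le_rfl
  · push Not at hy
    have hy0 : 0 < ‖y‖ := hR.trans_lt hy
    rw [norm_smul, Real.norm_of_nonneg (by positivity), div_mul_cancel₀ _ hy0.ne']
    exact hy.le

/-- Beyond the truncation radius `R₀ h^{-α}`, a lower power of `r` is controlled by a higher one
with a gain of two powers of `h`. -/
theorem rpow_le_of_truncation_radius_lt {R₀ α h r k q : ℝ} (hR₀ : 0 < R₀) (hh : 0 < h)
    (hh1 : h ≤ 1) (hr : R₀ * h ^ (-α) < r) (hkq : k ≤ q) (hgain : 2 ≤ α * (q - k)) :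
    r ^ k ≤ R₀ ^ (k - q) * h ^ 2 * r ^ q := by
  have hR : 0 < R₀ * h ^ (-α) := by positivity
  have hr0 : 0 < r := hR.trans hr
  have hsplit : r ^ k = r ^ (k - q) * r ^ q := by
    rw [← Real.rpow_add hr0, sub_add_cancel]
  have hradius : r ^ (k - q) ≤ (R₀ * h ^ (-α)) ^ (k - q) :=
    Real.rpow_le_rpow_of_nonpos hR hr.le (by linarith)
  have hpow : (R₀ * h ^ (-α)) ^ (k - q) = R₀ ^ (k - q) * h ^ (α * (q - k)) := by
    rw [Real.mul_rpow hR₀.le (by positivity), ← Real.rpow_mul hh.le]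
    ring_nf
  have hh2 : h ^ (α * (q - k)) ≤ h ^ 2 := by
    rw [← Real.rpow_two]
    exact Real.rpow_le_rpow_of_exponent_ge hh hh1 hgain
  rw [hsplit]
  gcongr
  rw [hpow] at hradius
  exact hradius.trans (by gcongr)

/-- The square of a mean is at most the mean of the square. -/
theorem sq_integral_le_integral_sq {Ω : Type*} [MeasurableSpace Ω] {μ : Measure Ω}
    [IsProbabilityMeasure μ] {X : Ω → ℝ} (hX : Integrable X μ)
    (hX2 : Integrable (fun ω => X ω ^ 2) μ) : (∫ ω, X ω ∂μ) ^ 2 ≤ ∫ ω, X ω ^ 2 ∂μ := by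
  set a := ∫ ω, X ω ∂μ with ha
  have hle : ∫ ω, 2 * a * X ω ∂μ ≤ ∫ ω, (a ^ 2 + X ω ^ 2) ∂μ :=
    integral_mono (hX.const_mul _) ((integrable_const _).add hX2)
      fun ω => by nlinarith [sq_nonneg (a - X ω)]
  rw [integral_const_mul, integral_add (integrable_const _) hX2, ← ha] at hle
  simp only [integral_const, probReal_univ, one_smul] at hle
  linarith

/-- Pointwise bound for the truncation error of a map with polynomially growing local Lipschitz
constant. -/
theorem norm_truncation_error_le {n m : ℕ} (hm : 2 ≤ m) {L R₀ α h q : ℝ} (hL : 0 ≤ L)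
    (hR₀ : 0 < R₀) (hα : 0 < α) (hh : 0 < h) (hh1 : h ≤ 1) (hq : 2 ≤ α * (q - m))
    {g : Vec n → Vec n}
    (hg : ∀ y y', ‖g y' - g y‖ ≤ L * (1 + ‖y'‖ ^ (m - 1) + ‖y‖ ^ (m - 1)) * ‖y' - y‖)
    (y : Vec n) :
    ‖(y - proj (R₀ * h ^ (-α)) y) + h • (g y - g (proj (R₀ * h ^ (-α)) y))‖ ≤
      ((1 + L) * R₀ ^ (1 - q) + 2 * L * R₀ ^ (m - q)) * h ^ 2 * ‖y‖ ^ q := by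
  set R := R₀ * h ^ (-α) with hRdef
  have hR : 0 < R := by positivity
  by_cases hy : ‖y‖ ≤ R
  · have hproj : proj R y = y := if_pos hy
    simp only [hproj, sub_self, smul_zero, add_zero, norm_zero]
    positivity
  · push Not at hy
    have hm1 : (1 : ℝ) ≤ m := by exact_mod_cast (by omega : 1 ≤ m)
    have hmq : (m : ℝ) ≤ q := by
      by_contra! hlt
      nlinarith [mul_pos hα (sub_pos.2 hlt)]
    have hlin : ‖y‖ ≤ R₀ ^ (1 - q) * h ^ 2 * ‖y‖ ^ q := by
      simpa using rpow_le_of_truncation_radius_lt (k := 1) hR₀ hh hh1 hy (by linarith)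
        (hq.trans (by gcongr))
    have hpoly : ‖y‖ ^ m ≤ R₀ ^ (m - q) * h ^ 2 * ‖y‖ ^ q := by
      simpa using rpow_le_of_truncation_radius_lt (k := m) hR₀ hh hh1 hy hmq hq
    have hgy : ‖g y - g (proj R y)‖ ≤ L * (‖y‖ + 2 * ‖y‖ ^ m) :=
      calc ‖g y - g (proj R y)‖
          ≤ L * (1 + ‖y‖ ^ (m - 1) + ‖proj R y‖ ^ (m - 1)) * ‖y - proj R y‖ := hg _ _
        _ ≤ L * (1 + ‖y‖ ^ (m - 1) + ‖y‖ ^ (m - 1)) * ‖y‖ := by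
            gcongr
            · exact norm_proj_le hR.le y
            · exact norm_sub_proj_le hR.le y
        _ = L * (‖y‖ + 2 * ‖y‖ ^ m) := by
            rw [← pow_sub_one_mul (by omega : m ≠ 0) ‖y‖]
            ring
    calc ‖(y - proj R y) + h • (g y - g (proj R y))‖
        ≤ ‖y - proj R y‖ + ‖h • (g y - g (proj R y))‖ := norm_add_le _ _
      _ = ‖y - proj R y‖ + h * ‖g y - g (proj R y)‖ := by
          rw [norm_smul, Real.norm_of_nonneg hh.le]
      _ ≤ ‖y‖ + 1 * (L * (‖y‖ + 2 * ‖y‖ ^ m)) := by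
          gcongr
          exact norm_sub_proj_le hR.le y
      _ = (1 + L) * ‖y‖ + 2 * L * ‖y‖ ^ m := by ring
      _ ≤ (1 + L) * (R₀ ^ (1 - q) * h ^ 2 * ‖y‖ ^ q)
            + 2 * L * (R₀ ^ (m - q) * h ^ 2 * ‖y‖ ^ q) := by gcongr
      _ = _ := by ring

/-- Truncation error for the `Y`-component: with `p = 6/α` and `f` satisfying (RegY), there is
`C ≥ 0` depending only on `L_y, m, R₀, α` (not on `h`) such that for all `h ∈ (0,1]`, all `Y`
with `E[|Y|^{4p}] < ∞` and all `ζ`,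
`|E[(Y − T^h(Y)) + (f(Y,ζ) − f(T^h(Y),ζ)) h]|² ≤ C (1 + E[|Y|^{4p}]) h³`. -/
theorem truncation_error_Y_bound
    {n d m : ℕ} (hn : 1 ≤ n) (hd : 1 ≤ d) (hm : 2 ≤ m)
    {L_y : ℝ} (hLy : 0 ≤ L_y)
    {R₀ α : ℝ} (hR₀ : 0 < R₀) (hα0 : 0 < α) (hα : α ≤ 1 / (2 * ((m : ℝ) - 1)))
    {p : ℝ} (hp : p = 6 / α) :
    ∃ C : ℝ, 0 ≤ C ∧
      ∀ (f : Vec n × Mat n d → Vec n),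
        (∀ (y y' : Vec n) (z : Mat n d),
          ‖f (y', z) - f (y, z)‖ ≤ L_y * (1 + ‖y'‖ ^ (m - 1) + ‖y‖ ^ (m - 1)) * ‖y' - y‖) →
      ∀ (h : ℝ), 0 < h → h ≤ 1 →
      ∀ (Ω : Type) [m0 : MeasurableSpace Ω] (μ : Measure Ω) [IsProbabilityMeasure μ],
      ∀ (Y : Ω → Vec n), Measurable Y → Integrable (fun ω => ‖Y ω‖ ^ (4 * p)) μ →
      ∀ (ζ : Ω → Mat n d),
        ‖∫ ω, ((Y ω - proj (R₀ * h ^ (-α)) (Y ω))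
            + h • (f (Y ω, ζ ω) - f (proj (R₀ * h ^ (-α)) (Y ω), ζ ω))) ∂μ‖ ^ 2
          ≤ C * (1 + ∫ ω, ‖Y ω‖ ^ (4 * p) ∂μ) * h ^ 3 := by
  have hm2 : (2 : ℝ) ≤ m := by exact_mod_cast hm
  have hαm : α * (m - 1) ≤ 1 / 2 := by
    rw [le_div_iff₀ (by linarith)] at hα
    linarith
  have hαp : α * p = 6 := by
    rw [hp]
    field_simp
  have hp0 : 0 < p := by
    rw [hp]
    positivity
  have hgain : 2 ≤ α * (2 * p - m) := by nlinarith
  set K : ℝ := (1 + L_y) * R₀ ^ (1 - 2 * p) + 2 * L_y * R₀ ^ (m - 2 * p) with hK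
  have hK0 : 0 ≤ K := by positivity
  refine ⟨K ^ 2, sq_nonneg K, ?_⟩
  intro f hf h hh hh1 Ω m0 μ hμ Y hY hint ζ
  have hsq : ∀ ω, (‖Y ω‖ ^ (2 * p)) ^ 2 = ‖Y ω‖ ^ (4 * p) := fun ω => by
    rw [← Real.rpow_mul_natCast (norm_nonneg _)]
    congr 1
    push_cast
    ring
  have hint2 : Integrable (fun ω => (‖Y ω‖ ^ (2 * p)) ^ 2) μ := by simpa only [hsq] using hint
  have hX : Integrable (fun ω => ‖Y ω‖ ^ (2 * p)) μ :=
    ((memLp_two_iff_integrable_sq (hY.norm.pow_const _).aestronglyMeasurable).2 hint2).integrable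
      one_le_two
  have hmoment : (∫ ω, ‖Y ω‖ ^ (2 * p) ∂μ) ^ 2 ≤ ∫ ω, ‖Y ω‖ ^ (4 * p) ∂μ := by
    simpa only [hsq] using sq_integral_le_integral_sq hX hint2
  have hbound := norm_integral_le_of_norm_le (hX.const_mul (K * h ^ 2))
    (ae_of_all μ fun ω => norm_truncation_error_le (g := fun y => f (y, ζ ω)) hm hLy hR₀ hα0 hh
      hh1 hgain (fun y y' => hf y y' (ζ ω)) (Y ω))
  rw [integral_const_mul] at hbound
  calc _ ≤ (K * h ^ 2 * ∫ ω, ‖Y ω‖ ^ (2 * p) ∂μ) ^ 2 := by gcongr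
    _ = K ^ 2 * (∫ ω, ‖Y ω‖ ^ (2 * p) ∂μ) ^ 2 * h ^ 4 := by ring
    _ ≤ K ^ 2 * (1 + ∫ ω, ‖Y ω‖ ^ (4 * p) ∂μ) * h ^ 3 := by
        have hh4 : h ^ 4 ≤ h ^ 3 := pow_le_pow_of_le_one hh.le hh1 (by norm_num)
        have hE : 0 ≤ (∫ ω, ‖Y ω‖ ^ (2 * p) ∂μ) ^ 2 := sq_nonneg _
        gcongr
        linarith

end
end

section
/- There exist constants C > 0 and h₀ ∈ (0,1) such that for every h ∈ (0, h₀], with G a real Gaussian random variable of mean 0 and variance h, and with the truncation level r^h = √(2h) · ln(1/h) and truncation map T^{r^h}(x) = max(−r^h, min(x, r^h)), one has E[ | G/h − T^{r^h}(G)/h |² ] ≤ C h; equivalently, E[ |G − T^{r^h}(G)|² ] ≤ C h³. In other words, the truncated Brownian-increment weight H = T^{r^h}(ΔW)/h satisfies the approximation property E[|ΔW/h − H|²] ≤ C h (in dimension d = 1). -/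
open MeasureTheory ProbabilityTheory Real

noncomputable section

/-- Projection of `x ∈ ℝ` onto the interval `[−r, r]`. -/
def trunc (r x : ℝ) : ℝ := max (-r) (min x r)

/-- The truncation level `r^h = √(2h) ln(1/h)`. -/
def truncLevel (h : ℝ) : ℝ := Real.sqrt (2 * h) * Real.log (1 / h)

/-- Exponential domination of the squared overshoot beyond the truncation level. -/
lemma sub_trunc_sq_le {r t : ℝ} (hr : 0 ≤ r) (ht : 0 < t) (x : ℝ) :
    (x - trunc r x) ^ 2 ≤ 2 / t ^ 2 * exp (-(t * r)) * (exp (t * x) + exp (-t * x)) := by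
  have key : ∀ y : ℝ, 0 ≤ y → y ^ 2 ≤ 2 / t ^ 2 * exp (t * y) := by
    intro y hy
    have h1 := quadratic_le_exp_of_nonneg (mul_nonneg ht.le hy)
    have h2 : 0 ≤ t * y := mul_nonneg ht.le hy
    rw [div_mul_eq_mul_div, le_div_iff₀ (by positivity)]
    nlinarith
  rcases le_total x r with hx | hx
  · rcases le_total (-r) x with hx' | hx'
    · rw [trunc, min_eq_left hx, max_eq_right hx', sub_self, zero_pow two_ne_zero]
      positivity
    · rw [trunc, min_eq_left hx, max_eq_left hx']
      calc (x - -r) ^ 2 = (-x - r) ^ 2 := by ring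
        _ ≤ 2 / t ^ 2 * exp (t * (-x - r)) := key _ (by linarith)
        _ = 2 / t ^ 2 * exp (-(t * r)) * exp (-t * x) := by
          rw [mul_assoc, ← exp_add]; ring_nf
        _ ≤ _ := by gcongr; linarith [exp_pos (t * x)]
  · rw [trunc, min_eq_right hx, max_eq_right (by linarith)]
    calc (x - r) ^ 2 ≤ 2 / t ^ 2 * exp (t * (x - r)) := key _ (by linarith)
      _ = 2 / t ^ 2 * exp (-(t * r)) * exp (t * x) := by
        rw [mul_assoc, ← exp_add]; ring_nf
      _ ≤ _ := by gcongr; linarith [exp_pos (-t * x)]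

lemma integral_exp_mul_gaussianReal_zero {h : ℝ} (hh : 0 ≤ h) (t : ℝ) :
    ∫ x, exp (t * x) ∂(gaussianReal 0 h.toNNReal) = exp (h * t ^ 2 / 2) := by
  have := congrFun (mgf_id_gaussianReal (μ := 0) (v := h.toNNReal)) t
  simpa [mgf, Real.coe_toNNReal h hh] using this

lemma integral_sub_trunc_sq_le {h : ℝ} (h_pos : 0 < h) (h_le : h ≤ 1) :
    ∫ x, (x - trunc (truncLevel h) x) ^ 2 ∂(gaussianReal 0 h.toNNReal)
      ≤ 2 * exp 1 * h ^ 3 := by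
  have hlog : 0 ≤ log (1 / h) := log_nonneg (by rwa [le_div_iff₀ h_pos, one_mul])
  have hr : 0 ≤ truncLevel h := mul_nonneg (sqrt_nonneg _) hlog
  set t : ℝ := sqrt (2 / h) with ht_def
  have ht : 0 < t := sqrt_pos.2 (by positivity)
  have ht2 : t ^ 2 = 2 / h := sq_sqrt (by positivity)
  have htr : exp (-(t * truncLevel h)) = h ^ 2 := by
    have h1 : t * sqrt (2 * h) = 2 := by
      rw [ht_def, ← sqrt_mul (by positivity), show 2 / h * (2 * h) = 2 ^ 2 by field_simp]
      exact sqrt_sq (by norm_num)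
    rw [truncLevel, ← mul_assoc, h1, one_div, log_inv,
      show -(2 * -log h) = log h + log h by ring, exp_add, exp_log h_pos, sq]
  have hint := fun s : ℝ ↦ integrable_exp_mul_gaussianReal (μ := 0) (v := h.toNNReal) s
  calc ∫ x, (x - trunc (truncLevel h) x) ^ 2 ∂(gaussianReal 0 h.toNNReal)
      ≤ ∫ x, h ^ 3 * (exp (t * x) + exp (-t * x)) ∂(gaussianReal 0 h.toNNReal) := by
        refine integral_mono_of_nonneg (.of_forall fun x ↦ sq_nonneg _)
          (((hint t).add (hint (-t))).const_mul _) (.of_forall fun x ↦ ?_)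
        have := sub_trunc_sq_le hr ht x
        rwa [htr, ht2, show 2 / (2 / h) * h ^ 2 = h ^ 3 by field_simp] at this
    _ = 2 * exp 1 * h ^ 3 := by
        rw [integral_const_mul, integral_add (hint t) (hint (-t)),
          integral_exp_mul_gaussianReal_zero h_pos.le, integral_exp_mul_gaussianReal_zero h_pos.le,
          neg_sq, ht2, show h * (2 / h) / 2 = 1 by field_simp]
        ring

/-- There are `C > 0` and `h₀ ∈ (0,1)` such that for every `h ∈ (0, h₀]`, a centered Gaussian
`G` of variance `h` satisfies `E[|G/h − T^{r^h}(G)/h|²] ≤ C h`, equivalently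
`E[|G − T^{r^h}(G)|²] ≤ C h³`: the truncated Brownian-increment weight `H = T^{r^h}(ΔW)/h`
satisfies the approximation property `E[|ΔW/h − H|²] ≤ C h` (in dimension `d = 1`). -/
theorem truncated_gaussian_weight_approximation :
    ∃ C : ℝ, 0 < C ∧ ∃ h₀ : ℝ, 0 < h₀ ∧ h₀ < 1 ∧
      ∀ h : ℝ, 0 < h → h ≤ h₀ →
        (∫ x, (x / h - trunc (truncLevel h) x / h) ^ 2 ∂(gaussianReal 0 h.toNNReal)) ≤ C * h
          ∧ (∫ x, (x - trunc (truncLevel h) x) ^ 2 ∂(gaussianReal 0 h.toNNReal)) ≤ C * h ^ 3 := by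
  refine ⟨2 * exp 1, by positivity, 1 / 2, by norm_num, by norm_num, fun h h_pos h_le ↦ ?_⟩
  have hmain := integral_sub_trunc_sq_le h_pos (by linarith)
  refine ⟨?_, hmain⟩
  simp_rw [← sub_div, div_pow]
  rw [integral_div, div_le_iff₀ (by positivity)]
  linarith

end
end

section
/- Let q ≥ 0 be an integer and let φ : ℝ → ℝ be (q+1)-times continuously differentiable with |φ^{(q+1)}(x)| ≤ M for all x ∈ ℝ. Let μ and ν be two probability measures on ℝ with ∫|x|^{q+1} dμ(x) < ∞ and ∫|x|^{q+1} dν(x) < ∞, whose moments agree up to order q: ∫ x^k dμ = ∫ x^k dν for every integer 0 ≤ k ≤ q. Then | ∫ φ dμ − ∫ φ dν | ≤ (M/(q+1)!) ( ∫ |x|^{q+1} dμ(x) + ∫ |x|^{q+1} dν(x) ). In particular, if μ = γ_{0,h} is the centered Gaussian measure of variance h and ν matches its moments up to order q and has (q+1)-st absolute moment bounded by a constant times h^{(q+1)/2}, the weak error on such test functions is of order h^{(q+1)/2}. -/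
open MeasureTheory Real

/-- The Maclaurin polynomial of degree at most `n` of a function on the real line. -/
noncomputable def maclaurinSum (n : ℕ) (f : ℝ → ℝ) (x : ℝ) : ℝ :=
  ∑ k ∈ Finset.range (n + 1), iteratedDeriv k f 0 / (Nat.factorial k) * x ^ k

theorem abs_sub_maclaurinSum_le {n : ℕ} {M : ℝ} {f : ℝ → ℝ} (hf : ContDiff ℝ (n + 1) f)
    (hbound : ∀ x : ℝ, |iteratedDeriv (n + 1) f x| ≤ M) (x : ℝ) :
    |f x - maclaurinSum n f x| ≤ M / (Nat.factorial (n + 1)) * |x| ^ (n + 1) := by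
  rcases eq_or_ne x 0 with rfl | hx
  · simp [maclaurinSum, Finset.sum_range_succ']
  have htaylor : taylorWithinEval f n (Set.uIcc 0 x) 0 x = maclaurinSum n f x := by
    rw [taylor_within_apply, maclaurinSum]
    refine Finset.sum_congr rfl fun k hk => ?_
    have hk' : (k : WithTop ℕ∞) ≤ n + 1 := by
      have := Finset.mem_range.1 hk
      exact_mod_cast this.le
    rw [iteratedDerivWithin_eq_iteratedDeriv (uniqueDiffOn_uIcc hx.symm)
      (hf.of_le hk').contDiffAt Set.left_mem_uIcc, sub_zero, smul_eq_mul]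
    ring
  obtain ⟨y, -, hy⟩ :=
    taylor_mean_remainder_lagrange_iteratedDeriv hx.symm (hf.contDiffOn (s := Set.uIcc 0 x))
  rw [← htaylor, hy, sub_zero, abs_div, abs_mul, abs_pow, Nat.abs_cast, div_mul_eq_mul_div]
  gcongr
  exact hbound y

theorem integrable_pow_of_integrable_abs_pow {m k : ℕ} (hk : k ≤ m) {μ : Measure ℝ}
    [IsFiniteMeasure μ] (hμ : Integrable (fun x => |x| ^ m) μ) :
    Integrable (fun x => x ^ k) μ := by
  refine ((integrable_const (1 : ℝ)).add hμ).mono' (by fun_prop) (.of_forall fun x => ?_)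
  simp only [Pi.add_apply, norm_pow, norm_eq_abs]
  rcases le_total |x| 1 with h | h
  · have := pow_le_one₀ (n := k) (abs_nonneg x) h
    have : 0 ≤ |x| ^ m := by positivity
    linarith
  · have := pow_le_pow_right₀ h hk
    linarith

theorem integrable_maclaurinSum {n : ℕ} (f : ℝ → ℝ) {μ : Measure ℝ} [IsFiniteMeasure μ]
    (hμ : Integrable (fun x => |x| ^ (n + 1)) μ) : Integrable (maclaurinSum n f) μ :=
  integrable_finsetSum _ fun _ hk =>
    (integrable_pow_of_integrable_abs_pow (Finset.mem_range.1 hk).le hμ).const_mul _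

theorem integral_maclaurinSum {n : ℕ} (f : ℝ → ℝ) {μ : Measure ℝ} [IsFiniteMeasure μ]
    (hμ : Integrable (fun x => |x| ^ (n + 1)) μ) :
    ∫ x, maclaurinSum n f x ∂μ =
      ∑ k ∈ Finset.range (n + 1), iteratedDeriv k f 0 / (Nat.factorial k) * ∫ x, x ^ k ∂μ := by
  simp_rw [maclaurinSum]
  rw [integral_finsetSum _ fun k hk =>
    (integrable_pow_of_integrable_abs_pow (Finset.mem_range.1 hk).le hμ).const_mul _]
  simp_rw [integral_const_mul]

theorem abs_integral_sub_integral_maclaurinSum_le {n : ℕ} {M : ℝ} {f : ℝ → ℝ}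
    (hf : ContDiff ℝ (n + 1) f) (hbound : ∀ x : ℝ, |iteratedDeriv (n + 1) f x| ≤ M)
    {μ : Measure ℝ} [IsFiniteMeasure μ] (hμ : Integrable (fun x => |x| ^ (n + 1)) μ) :
    |(∫ x, f x ∂μ) - ∫ x, maclaurinSum n f x ∂μ|
      ≤ M / (Nat.factorial (n + 1)) * ∫ x, |x| ^ (n + 1) ∂μ := by
  have hP := integrable_maclaurinSum f hμ
  have hle := abs_sub_maclaurinSum_le hf hbound
  have hR : Integrable (fun x => f x - maclaurinSum n f x) μ :=
    (hμ.const_mul (M / (Nat.factorial (n + 1)))).mono'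
      (hf.continuous.aestronglyMeasurable.sub hP.aestronglyMeasurable) (.of_forall hle)
  have hfi : Integrable f μ := (hR.add hP).congr (.of_forall fun x => by simp)
  rw [← integral_sub hfi hP, ← integral_const_mul, ← norm_eq_abs]
  exact norm_integral_le_of_norm_le (hμ.const_mul _) (ae_of_all _ fun x => hle x)

/-- Weak-error bound from moment matching: if `φ` is `(q+1)`-times continuously differentiable
with `|φ^{(q+1)}| ≤ M`, and the probability measures `μ, ν` have finite `(q+1)`-st absolute
moments and matching moments up to order `q`, then
`|∫ φ dμ − ∫ φ dν| ≤ (M/(q+1)!)(∫|x|^{q+1} dμ + ∫|x|^{q+1} dν)`. -/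
theorem weak_error_of_moment_matching
    (q : ℕ) (M : ℝ) (φ : ℝ → ℝ)
    (hφ : ContDiff ℝ (q + 1) φ)
    (hbound : ∀ x : ℝ, |iteratedDeriv (q + 1) φ x| ≤ M)
    (μ ν : Measure ℝ) [IsProbabilityMeasure μ] [IsProbabilityMeasure ν]
    (hμ : Integrable (fun x => |x| ^ (q + 1)) μ)
    (hν : Integrable (fun x => |x| ^ (q + 1)) ν)
    (hmom : ∀ k ≤ q, (∫ x, x ^ k ∂μ) = ∫ x, x ^ k ∂ν) :
    |(∫ x, φ x ∂μ) - ∫ x, φ x ∂ν|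
      ≤ M / (Nat.factorial (q + 1))
          * ((∫ x, |x| ^ (q + 1) ∂μ) + ∫ x, |x| ^ (q + 1) ∂ν) := by
  have hpoly : ∫ x, maclaurinSum q φ x ∂μ = ∫ x, maclaurinSum q φ x ∂ν := by
    rw [integral_maclaurinSum φ hμ, integral_maclaurinSum φ hν]
    refine Finset.sum_congr rfl fun k hk => ?_
    rw [hmom k (Nat.lt_succ_iff.1 (Finset.mem_range.1 hk))]
  have h₁ := abs_integral_sub_integral_maclaurinSum_le hφ hbound hμ
  have h₂ := abs_integral_sub_integral_maclaurinSum_le hφ hbound hν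
  rw [hpoly] at h₁
  rw [abs_sub_comm] at h₂
  rw [mul_add]
  exact (abs_sub_le _ _ _).trans (add_le_add h₁ h₂)
end
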